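/- arXiv:2004.10549 — 2 statements merged into one kernel-verified Lean document; each statement's English description precedes it below -/
import Mathlib

section
/- Let X be a nonempty compact metric space, l ≥ 1, and J = (J_1, …, J_l) : X → ℝ^l with each J_i lower semicontinuous. Set Y = J(X) ⊆ ℝ^l. Then the set of nondominated points of Y equals the set of nondominated points of the closure cl(Y); in particular, every nondominated point of cl(Y) is attained, i.e., lies in Y. -/
/-- The upper closure of the range of a family of lower semicontinuous functions on a compact
space is closed. -/
theorem isClosed_setOf_exists_forall_le {X ι : Type*} [TopologicalSpace X] [CompactSpace X]
    {J : ι → X → ℝ} (hJ : ∀ i, LowerSemicontinuous (J i)) :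
    IsClosed {y : ι → ℝ | ∃ x, ∀ i, J i x ≤ y i} := by
  have hE : IsClosed {p : X × (ι → ℝ) | ∀ i, J i p.1 ≤ p.2 i} := by
    rw [Set.ofPred_forall]
    refine isClosed_iInter fun i => ?_
    have hc : Continuous fun p : X × (ι → ℝ) => (p.1, p.2 i) := by fun_prop
    exact (lowerSemicontinuous_iff_isClosed_epigraph.1 (hJ i)).preimage hc
  convert isClosedMap_snd_of_compactSpace _ hE using 1
  ext y
  simp

/-- Every point of the closure of the range of a family of lower semicontinuous functions on a
compact space is weakly dominated by a point of the range. -/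
theorem exists_forall_le_of_mem_closure_range {X ι : Type*} [TopologicalSpace X]
    [CompactSpace X] {J : ι → X → ℝ} (hJ : ∀ i, LowerSemicontinuous (J i)) {y : ι → ℝ}
    (hy : y ∈ closure (Set.range fun x i => J i x)) : ∃ x, ∀ i, J i x ≤ y i := by
  refine closure_minimal ?_ (isClosed_setOf_exists_forall_le hJ) hy
  rintro _ ⟨x, rfl⟩
  exact ⟨x, fun _ => le_rfl⟩

/-- For lower semicontinuous objectives on a nonempty compact metric space, the set of
nondominated points of the image `Y = J(X)` coincides with the set of nondominated
points of its closure `cl(Y)`; in particular every nondominated point of `cl(Y)` lies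
in `Y`. -/
theorem nondominated_image_eq_nondominated_closure
    {X : Type*} [MetricSpace X] [CompactSpace X] [Nonempty X]
    {l : ℕ} (hl : 1 ≤ l) (J : Fin l → X → ℝ)
    (hJ : ∀ i, LowerSemicontinuous (J i)) :
    {y ∈ Set.range (fun x i => J i x) |
        ¬ ∃ z ∈ Set.range (fun x i => J i x),
          (∀ i, z i ≤ y i) ∧ ∃ i, z i < y i} =
      {y ∈ closure (Set.range (fun x i => J i x)) |
        ¬ ∃ z ∈ closure (Set.range (fun x i => J i x)),
          (∀ i, z i ≤ y i) ∧ ∃ i, z i < y i} := by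
  ext y
  constructor
  · rintro ⟨hy, hnd⟩
    refine ⟨subset_closure hy, ?_⟩
    rintro ⟨z, hz, hle, i, hi⟩
    obtain ⟨x, hx⟩ := exists_forall_le_of_mem_closure_range hJ hz
    exact hnd ⟨_, ⟨x, rfl⟩, fun j => (hx j).trans (hle j), i, (hx i).trans_lt hi⟩
  · rintro ⟨hy, hnd⟩
    refine ⟨?_, fun ⟨z, hz, h⟩ => hnd ⟨z, subset_closure hz, h⟩⟩
    obtain ⟨x, hx⟩ := exists_forall_le_of_mem_closure_range hJ hy
    refine ⟨x, funext fun i => (hx i).antisymm (not_lt.1 fun hi => ?_)⟩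
    exact hnd ⟨_, subset_closure ⟨x, rfl⟩, hx, i, hi⟩
end

section
/- Let d ≥ 1, let Ω^ext ⊂ ℝ^d be a nonempty compact set, let Ω_0 ⊆ Ω^ext be a nonempty compact set, and fix α ∈ (0,1] and K ≥ 0. Let F be the set of all bijections ψ : Ω^ext → Ω^ext such that both ψ and ψ^{-1} are α-Hölder with constant K. Then the family of shapes O = { ψ(Ω_0) : ψ ∈ F }, regarded as a set of nonempty compact subsets of ℝ^d, is compact with respect to the Hausdorff distance. -/
theorem tendsto_mul_rpow_nhds_zero (K : ℝ) {α : ℝ} (hα : 0 < α) :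
    Filter.Tendsto (fun t : ℝ => K * t ^ α) (nhds 0) (nhds 0) := by
  have h := ((Real.continuous_rpow_const hα.le).const_mul K).tendsto (0 : ℝ)
  simpa [Real.zero_rpow hα.ne'] using h

theorem continuous_of_dist_le_mul_rpow {X Y : Type*} [PseudoMetricSpace X] [PseudoMetricSpace Y]
    {K α : ℝ} (hα : 0 < α) {f : X → Y} (hf : ∀ x y, dist (f x) (f y) ≤ K * dist x y ^ α) :
    Continuous f :=
  (Metric.equicontinuous_of_continuity_modulus _ (tendsto_mul_rpow_nhds_zero K hα)
    (fun _ : Unit => f) fun x y _ => hf x y).continuous ()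

/-- Maps into a compact metric space that are Hölder with given exponent and constant form a
compact set in the compact-open topology. -/
theorem ContinuousMap.isCompact_setOf_dist_le_rpow {X Y : Type*} [PseudoMetricSpace X]
    [MetricSpace Y] [CompactSpace Y] (K : ℝ) {α : ℝ} (hα : 0 < α) :
    IsCompact {f : C(X, Y) | ∀ x y, dist (f x) (f y) ≤ K * dist x y ^ α} := by
  apply ArzelaAscoli.isCompact_of_equicontinuous
  · have himage : ContinuousMap.toFun '' {f : C(X, Y) | ∀ x y, dist (f x) (f y) ≤ K * dist x y ^ α}
        = {f : X → Y | ∀ x y, dist (f x) (f y) ≤ K * dist x y ^ α} := by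
      ext f
      constructor
      · rintro ⟨g, hg, rfl⟩
        exact hg
      · intro hf
        exact ⟨⟨f, continuous_of_dist_le_mul_rpow hα hf⟩, hf, rfl⟩
    rw [himage]
    apply IsClosed.isCompact
    simp only [Set.ofPred_forall]
    exact isClosed_iInter fun x => isClosed_iInter fun y =>
      isClosed_le ((continuous_apply x).dist (continuous_apply y)) continuous_const
  · exact Metric.equicontinuous_of_continuity_modulus _ (tendsto_mul_rpow_nhds_zero K hα) _
      fun x y f => f.2 x y

/-- The pairs of mutually inverse self-maps of a compact metric space that are both Hölder with
given exponent and constant form a compact set. -/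
theorem ContinuousMap.isCompact_setOf_inverse_dist_le_rpow {X : Type*} [MetricSpace X]
    [CompactSpace X] (K : ℝ) {α : ℝ} (hα : 0 < α) :
    IsCompact {p : C(X, X) × C(X, X) |
      ((∀ x y, dist (p.1 x) (p.1 y) ≤ K * dist x y ^ α) ∧
        ∀ x y, dist (p.2 x) (p.2 y) ≤ K * dist x y ^ α) ∧
      (∀ x, p.2 (p.1 x) = x) ∧ ∀ x, p.1 (p.2 x) = x} := by
  refine ((ContinuousMap.isCompact_setOf_dist_le_rpow K hα).prod
    (ContinuousMap.isCompact_setOf_dist_le_rpow K hα)).inter_right (IsClosed.inter ?_ ?_)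
  · change IsClosed {p : C(X, X) × C(X, X) | ∀ x, p.2 (p.1 x) = x}
    simp only [Set.ofPred_forall]
    exact isClosed_iInter fun x => isClosed_eq (by fun_prop) continuous_const
  · change IsClosed {p : C(X, X) × C(X, X) | ∀ x, p.1 (p.2 x) = x}
    simp only [Set.ofPred_forall]
    exact isClosed_iInter fun x => isClosed_eq (by fun_prop) continuous_const

/-- Compactness of the family of admissible shapes: the images of a fixed nonempty
compact baseline shape `Ω₀ ⊆ Ωext ⊂ ℝ^d` under bijections of `Ωext` that are
`α`-Hölder with constant `K` together with their inverses form a compact family of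
nonempty compact subsets of `ℝ^d` with respect to the Hausdorff distance. -/
theorem admissible_shapes_compact_hausdorff
    {d : ℕ} (hd : 1 ≤ d)
    (Ωext Ω₀ : Set (EuclideanSpace ℝ (Fin d)))
    (hext : IsCompact Ωext) (hextne : Ωext.Nonempty)
    (h0sub : Ω₀ ⊆ Ωext) (h0c : IsCompact Ω₀) (h0ne : Ω₀.Nonempty)
    {α K : ℝ} (hα0 : 0 < α) (hα1 : α ≤ 1) (hK : 0 ≤ K) :
    IsCompact {S : TopologicalSpace.NonemptyCompacts (EuclideanSpace ℝ (Fin d)) |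
      ∃ ψ φ : EuclideanSpace ℝ (Fin d) → EuclideanSpace ℝ (Fin d),
        Set.MapsTo ψ Ωext Ωext ∧ Set.MapsTo φ Ωext Ωext ∧
        (∀ x ∈ Ωext, φ (ψ x) = x) ∧ (∀ x ∈ Ωext, ψ (φ x) = x) ∧
        (∀ x ∈ Ωext, ∀ y ∈ Ωext, dist (ψ x) (ψ y) ≤ K * dist x y ^ α) ∧
        (∀ x ∈ Ωext, ∀ y ∈ Ωext, dist (φ x) (φ y) ≤ K * dist x y ^ α) ∧
        (S : Set (EuclideanSpace ℝ (Fin d))) = ψ '' Ω₀} := by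
  have : CompactSpace Ωext := isCompact_iff_compactSpace.mp hext
  let T : TopologicalSpace.NonemptyCompacts Ωext :=
    ⟨⟨Subtype.val ⁻¹' Ω₀, (h0c.isClosed.preimage continuous_subtype_val).isCompact⟩,
      h0ne.elim fun x hx => ⟨⟨x, h0sub hx⟩, hx⟩⟩
  have hcont : Continuous fun p : C(Ωext, Ωext) × C(Ωext, Ωext) =>
      (T.map p.1 p.1.continuous).map Subtype.val continuous_subtype_val :=
    continuous_subtype_val.nonemptyCompacts_map.comp <|
      Continuous.nonemptyCompacts_map' continuous_const
        (g := fun (p : C(Ωext, Ωext) × C(Ωext, Ωext)) x => p.1 x) (by fun_prop)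
  convert (ContinuousMap.isCompact_setOf_inverse_dist_le_rpow (X := Ωext) K hα0).image hcont
  ext S
  constructor
  · rintro ⟨ψ, φ, hψ, hφ, hφψ, hψφ, hψK, hφK, hS⟩
    have hcψ : Continuous (hψ.restrict ψ Ωext Ωext) :=
      continuous_of_dist_le_mul_rpow hα0 fun x y => hψK x x.2 y y.2
    have hcφ : Continuous (hφ.restrict φ Ωext Ωext) :=
      continuous_of_dist_le_mul_rpow hα0 fun x y => hφK x x.2 y y.2
    refine ⟨(⟨_, hcψ⟩, ⟨_, hcφ⟩), ⟨⟨fun x y => hψK x x.2 y y.2, fun x y => hφK x x.2 y y.2⟩,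
      fun x => Subtype.ext (hφψ x x.2), fun x => Subtype.ext (hψφ x x.2)⟩, ?_⟩
    apply SetLike.coe_injective
    rw [hS]
    ext z
    constructor
    · rintro ⟨_, ⟨x, hx, rfl⟩, rfl⟩
      exact ⟨x, hx, rfl⟩
    · rintro ⟨x, hx, rfl⟩
      exact ⟨_, ⟨⟨x, h0sub hx⟩, hx, rfl⟩, rfl⟩
  · rintro ⟨⟨f, g⟩, ⟨⟨hf, hg⟩, hgf, hfg⟩, rfl⟩
    classical
    let extend (h : C(Ωext, Ωext)) (x : EuclideanSpace ℝ (Fin d)) : EuclideanSpace ℝ (Fin d) :=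
      if hx : x ∈ Ωext then h ⟨x, hx⟩ else x
    have hextend (h : C(Ωext, Ωext)) (x : Ωext) : extend h x = h x := by
      simp [extend]
    refine ⟨extend f, extend g, fun x hx => ?_, fun x hx => ?_, fun x hx => ?_, fun x hx => ?_,
      fun x hx y hy => ?_, fun x hx y hy => ?_, ?_⟩
    · rw [hextend f ⟨x, hx⟩]
      exact (f _).2
    · rw [hextend g ⟨x, hx⟩]
      exact (g _).2
    · rw [hextend f ⟨x, hx⟩, hextend g, hgf]
    · rw [hextend g ⟨x, hx⟩, hextend f, hfg]
    · rw [hextend f ⟨x, hx⟩, hextend f ⟨y, hy⟩]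
      exact hf ⟨x, hx⟩ ⟨y, hy⟩
    · rw [hextend g ⟨x, hx⟩, hextend g ⟨y, hy⟩]
      exact hg ⟨x, hx⟩ ⟨y, hy⟩
    · ext z
      constructor
      · rintro ⟨_, ⟨x, hx, rfl⟩, rfl⟩
        exact ⟨x, hx, hextend f x⟩
      · rintro ⟨x, hx, rfl⟩
        exact ⟨_, ⟨⟨x, h0sub hx⟩, hx, rfl⟩, (hextend f ⟨x, h0sub hx⟩).symm⟩
end
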